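/- Let d ≥ 1, R = (R_1,…,R_d) with all R_j > 0, u = max{R_1,…,R_d}, v = min{R_1,…,R_d}, p = max{1/2, u}, g(R) = (1/R_1+…+1/R_d)^{-1}, and E = 4^{p/v} · 2^{u/v} · (1+1/(2v))^{u/(2v²)} · (2ep)^{1/(2v)}. Then for every integer n > E^d one has n^{g(R)} · σ_{R,d}(n) ≥ 2^{v−p} · (e(d+2u))^{-1/2}. -/

import Mathlib

/-- nonincreasing rearrangement of the weights `(1 + Σ_j |k_j|^{2R_j})^{-1/2}`, `k ∈ ℤ^d`. -/
noncomputable def sigmaR (d : ℕ) (R : Fin d → ℝ) (n : ℕ) : ℝ :=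
  sSup {t : ℝ | 0 < t ∧
    n ≤ Set.ncard {k : Fin d → ℤ |
      t ≤ (1 + ∑ j, |(k j : ℝ)| ^ (2 * R j)) ^ (-(1 / 2) : ℝ)}}

/-- The superlevel sets of the weights at positive heights are finite. -/
theorem finite_weight_ge {d : ℕ} {R : Fin d → ℝ} (hR : ∀ j, 0 < R j) {t : ℝ} (ht : 0 < t) :
    {k : Fin d → ℤ |
      t ≤ (1 + ∑ j, |(k j : ℝ)| ^ (2 * R j)) ^ (-(1 / 2) : ℝ)}.Finite := by
  set M : ℝ := t ^ (-2 : ℝ)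
  refine (Set.Finite.pi' fun j : Fin d =>
    Set.finite_Icc (-⌈M ^ (2 * R j)⁻¹⌉) ⌈M ^ (2 * R j)⁻¹⌉).subset ?_
  intro k hk j
  have hnn : ∀ i, 0 ≤ |(k i : ℝ)| ^ (2 * R i) := fun i => by positivity
  have hs : 0 < 1 + ∑ i, |(k i : ℝ)| ^ (2 * R i) := by
    have := Finset.sum_nonneg fun i (_ : i ∈ Finset.univ) => hnn i
    linarith
  have hsM : 1 + ∑ i, |(k i : ℝ)| ^ (2 * R i) ≤ M := by
    have := Real.rpow_le_rpow_of_nonpos ht hk (show (-2 : ℝ) ≤ 0 by norm_num)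
    rw [← Real.rpow_mul hs.le] at this
    norm_num at this
    simpa [M] using this
  have hj : |(k j : ℝ)| ^ (2 * R j) ≤ M := by
    have := Finset.single_le_sum (fun i _ => hnn i) (Finset.mem_univ j)
    linarith
  have h2R : 0 < 2 * R j := by linarith [hR j]
  have hkj : |(k j : ℝ)| ≤ M ^ (2 * R j)⁻¹ := by
    have := Real.rpow_le_rpow (hnn j) hj (inv_nonneg.2 h2R.le)
    rwa [Real.rpow_rpow_inv (abs_nonneg _) h2R.ne'] at this
  have hc : |k j| ≤ ⌈M ^ (2 * R j)⁻¹⌉ := by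
    exact_mod_cast hkj.trans (Int.le_ceil _)
  exact abs_le.1 hc

/-- A positive height whose superlevel set has at least `n ≥ 1` points bounds `sigmaR` below. -/
theorem le_sigmaR {d n : ℕ} {R : Fin d → ℝ} (hn : 1 ≤ n) {t : ℝ} (ht : 0 < t)
    (hcard : n ≤ Set.ncard {k : Fin d → ℤ |
      t ≤ (1 + ∑ j, |(k j : ℝ)| ^ (2 * R j)) ^ (-(1 / 2) : ℝ)}) :
    t ≤ sigmaR d R n := by
  refine le_csSup ⟨1, ?_⟩ ⟨ht, hcard⟩
  rintro s ⟨-, hs⟩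
  obtain ⟨k, hk⟩ := Set.nonempty_of_ncard_ne_zero (Nat.pos_iff_ne_zero.1 (hn.trans hs))
  refine le_trans hk (Real.rpow_le_one_of_one_le_of_nonpos ?_ (by norm_num))
  have : 0 ≤ ∑ j, |(k j : ℝ)| ^ (2 * R j) := Finset.sum_nonneg fun i _ => by positivity
  linarith

/-- The box `|k_j| ≤ n^{g/R_j}`, with `g = (Σ_j 1/R_j)⁻¹`, contains at least `n` integer points. -/
theorem le_card_box {d n : ℕ} (hd : 1 ≤ d) {R : Fin d → ℝ} (hR : ∀ j, 0 < R j) (hn : 1 ≤ n) :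
    n ≤ (Fintype.piFinset fun j : Fin d =>
      Finset.Icc (-⌊(n : ℝ) ^ ((∑ i, 1 / R i)⁻¹ / R j)⌋)
        ⌊(n : ℝ) ^ ((∑ i, 1 / R i)⁻¹ / R j)⌋).card := by
  have hn0 : (0 : ℝ) < n := by exact_mod_cast hn
  have hS : 0 < ∑ i, 1 / R i :=
    Finset.sum_pos (fun i _ => one_div_pos.2 (hR i)) ⟨⟨0, hd⟩, Finset.mem_univ _⟩
  set g := (∑ i, 1 / R i)⁻¹ with hg
  have hprod : ∏ j, (n : ℝ) ^ (g / R j) = n := by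
    rw [← Real.rpow_sum_of_pos hn0]
    have : ∑ j, g / R j = 1 := by
      simp_rw [div_eq_mul_one_div g, ← Finset.mul_sum]
      exact inv_mul_cancel₀ hS.ne'
    rw [this, Real.rpow_one]
  rw [Fintype.card_piFinset, ← Nat.cast_le (α := ℝ), Nat.cast_prod]
  nth_rewrite 1 [← hprod]
  refine Finset.prod_le_prod (fun j _ => by positivity) fun j _ => ?_
  set x := (n : ℝ) ^ (g / R j)
  have hf : 0 ≤ ⌊x⌋ := Int.floor_nonneg.2 (by positivity)
  have hle : ⌊x⌋ + 1 ≤ ((Finset.Icc (-⌊x⌋) ⌊x⌋).card : ℤ) := by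
    rw [Int.card_Icc]
    omega
  calc x ≤ ((⌊x⌋ + 1 : ℤ) : ℝ) := by
        push_cast
        exact (Int.lt_floor_add_one x).le
    _ ≤ _ := by exact_mod_cast hle

/-- Lower bound for the rearranged weights, valid for every `n ≥ 1`. -/
theorem succ_mul_rpow_le_sigmaR {d n : ℕ} (hd : 1 ≤ d) {R : Fin d → ℝ} (hR : ∀ j, 0 < R j)
    (hn : 1 ≤ n) :
    (((d : ℝ) + 1) * (n : ℝ) ^ (2 * (∑ j, 1 / R j)⁻¹)) ^ (-(1 / 2) : ℝ) ≤ sigmaR d R n := by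
  have hn1 : (1 : ℝ) ≤ n := by exact_mod_cast hn
  have hn0 : (0 : ℝ) < n := by linarith
  have hg0 : 0 ≤ (∑ i, 1 / R i)⁻¹ :=
    inv_nonneg.2 (Finset.sum_nonneg fun i _ => (one_div_pos.2 (hR i)).le)
  have hpos : 0 < (((d : ℝ) + 1) * (n : ℝ) ^ (2 * (∑ j, 1 / R j)⁻¹)) ^ (-(1 / 2) : ℝ) := by
    positivity
  refine le_sigmaR hn hpos ((le_card_box hd hR hn).trans ?_)
  rw [← Set.ncard_coe_finset]
  refine Set.ncard_le_ncard (fun k hk => ?_) (finite_weight_ge hR hpos)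
  have hk := Fintype.mem_piFinset.1 (Finset.mem_coe.1 hk)
  set g := (∑ i, 1 / R i)⁻¹
  have hterm : ∀ j, |(k j : ℝ)| ^ (2 * R j) ≤ (n : ℝ) ^ (2 * g) := fun j => by
    have h1 : |k j| ≤ ⌊(n : ℝ) ^ (g / R j)⌋ := abs_le.2 (Finset.mem_Icc.1 (hk j))
    have h2 : |(k j : ℝ)| ≤ (n : ℝ) ^ (g / R j) := by
      exact_mod_cast Int.le_floor.1 h1
    have hRj := hR j
    calc |(k j : ℝ)| ^ (2 * R j) ≤ ((n : ℝ) ^ (g / R j)) ^ (2 * R j) :=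
          Real.rpow_le_rpow (abs_nonneg _) h2 (by linarith)
      _ = (n : ℝ) ^ (2 * g) := by
          rw [← Real.rpow_mul hn0.le]
          congr 1
          field_simp
  have hsum : ∑ j, |(k j : ℝ)| ^ (2 * R j) ≤ d * (n : ℝ) ^ (2 * g) := by
    simpa using Finset.sum_le_sum fun j (_ : j ∈ Finset.univ) => hterm j
  have hsum0 : 0 ≤ ∑ j, |(k j : ℝ)| ^ (2 * R j) := Finset.sum_nonneg fun i _ => by positivity
  have hone : 1 ≤ (n : ℝ) ^ (2 * g) := Real.one_le_rpow hn1 (by linarith)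
  exact Real.rpow_le_rpow_of_nonpos (by linarith) (by linarith) (by norm_num)

/-- with `u = max R`, `v = min R`, `p = max{1/2, u}`,
`g(R) = (Σ_j 1/R_j)⁻¹` and `E = 4^{p/v}·2^{u/v}·(1+1/(2v))^{u/(2v²)}·(2ep)^{1/(2v)}`,
for every integer `n > E^d` one has `n^{g(R)}·σ_{R,d}(n) ≥ 2^{v−p}·(e(d+2u))^{-1/2}`. -/
theorem stmt_7 (d : ℕ) (hd : 1 ≤ d) (R : Fin d → ℝ) (hR : ∀ j, 0 < R j)
    (u v : ℝ) (hu : IsGreatest (Set.range R) u) (hv : IsLeast (Set.range R) v)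
    (p : ℝ) (hp : p = max (1/2 : ℝ) u)
    (g : ℝ) (hg : g = (∑ j, 1 / R j)⁻¹)
    (E : ℝ) (hE : E = 4 ^ (p / v) * 2 ^ (u / v)
      * (1 + 1 / (2 * v)) ^ (u / (2 * v ^ 2)) * (2 * Real.exp 1 * p) ^ (1 / (2 * v)))
    (n : ℕ) (hn : E ^ (d : ℝ) < n) :
    2 ^ (v - p) * (Real.exp 1 * (d + 2 * u)) ^ (-(1 / 2) : ℝ)
      ≤ (n : ℝ) ^ g * sigmaR d R n := by
  have huv : v ≤ u := hv.2 hu.1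
  have hv0 : 0 < v := by
    obtain ⟨j, rfl⟩ := hv.1
    exact hR j
  have hpu : u ≤ p := hp ▸ le_max_right _ _
  have hE0 : 0 ≤ E := by
    have hp0 : 0 < p := by linarith
    rw [hE]
    positivity
  have hn1 : 1 ≤ n := by
    have : (0 : ℝ) < n := (Real.rpow_nonneg hE0 _).trans_lt hn
    exact_mod_cast this
  have hn0 : (0 : ℝ) < n := by exact_mod_cast hn1
  have hd1 : (1 : ℝ) ≤ d := by exact_mod_cast hd
  have hσ := succ_mul_rpow_le_sigmaR hd hR hn1
  rw [← hg, Real.mul_rpow (by positivity) (by positivity), ← Real.rpow_mul hn0.le,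
    show 2 * g * (-(1 / 2)) = -g by ring] at hσ
  have htwo : (2 : ℝ) ≤ Real.exp 1 := by linarith [Real.add_one_le_exp (1 : ℝ)]
  have hbase : (d : ℝ) + 1 ≤ Real.exp 1 * (d + 2 * u) := by
    nlinarith
  calc 2 ^ (v - p) * (Real.exp 1 * (d + 2 * u)) ^ (-(1 / 2) : ℝ)
      ≤ 1 * ((d : ℝ) + 1) ^ (-(1 / 2) : ℝ) :=
        mul_le_mul (Real.rpow_le_one_of_one_le_of_nonpos (by norm_num) (by linarith))
          (Real.rpow_le_rpow_of_nonpos (by positivity) hbase (by norm_num))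
          (Real.rpow_nonneg (by linarith) _) zero_le_one
    _ = (n : ℝ) ^ g * (((d : ℝ) + 1) ^ (-(1 / 2) : ℝ) * (n : ℝ) ^ (-g)) := by
        rw [mul_left_comm, ← Real.rpow_add hn0, add_neg_cancel, Real.rpow_zero, one_mul, mul_one]
    _ ≤ (n : ℝ) ^ g * sigmaR d R n := by gcongr
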